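/- arXiv:1511.05894 — 3 statements merged into one kernel-verified Lean document; each statement's English description precedes it below -/
import Mathlib

section
/- Let B be a complex Banach space, let L' > L > 0, T ≥ 0, C > 0, and 1 < R₀ < R. Suppose g is holomorphic on Ω := {λ ∈ ℂ : Re λ > R₀, −L' log(Re λ) < Im λ < 1} with values in B and satisfies ‖g(λ)‖ ≤ C (Re λ)^{−2} e^{T|Im λ|} for all λ ∈ Ω. Then for every real t ≥ T, ∫_R^∞ e^{−itσ} g(σ) dσ = −i ∫₀^{L log R} e^{−it(R−iy)} g(R−iy) dy + ∫_R^∞ e^{−it(σ − iL log σ)} g(σ − iL log σ)(1 − iL/σ) dσ, and all three integrals converge absolutely. -/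
open MeasureTheory Set

lemma logContour_convex (L' R₀ : ℝ) (hL' : 0 < L') (hR₀ : 1 < R₀) :
    Convex ℝ {z : ℂ | R₀ < z.re ∧ -L' * Real.log z.re < z.im ∧ z.im < 1} := by
  intro z hz w hw a b ha hb hab
  obtain ⟨h1, h2, h3⟩ := hz
  obtain ⟨k1, k2, k3⟩ := hw
  have hlog := strictConcaveOn_log_Ioi.concaveOn.2 (show z.re ∈ Ioi (0:ℝ) from by
    simp only [mem_Ioi]; linarith) (show w.re ∈ Ioi (0:ℝ) from by
    simp only [mem_Ioi]; linarith) ha hb hab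
  simp only [smul_eq_mul] at hlog
  have hb' : b = 1 - a := by linarith
  have e1 : (a • z + b • w).re = a * z.re + b * w.re := by simp
  have e2 : (a • z + b • w).im = a * z.im + b * w.im := by simp
  simp only [mem_ofPred_eq, e1, e2]
  have key : ∀ p q : ℝ, 0 < p → 0 < q → 0 < a * p + b * q := by
    intro p q hp hq
    rcases ha.eq_or_lt with h | h
    · have : b = 1 := by linarith
      subst this; rw [← h]; linarith
    · have := mul_pos h hp
      have := mul_nonneg hb hq.le
      linarith
  refine ⟨?_, ?_, ?_⟩
  · have := key _ _ (sub_pos.2 h1) (sub_pos.2 k1)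
    have e : a * (z.re - R₀) + b * (w.re - R₀) = a * z.re + b * w.re - R₀ := by
      subst hb'; ring
    linarith
  · have := key _ _ (sub_pos.2 h2) (sub_pos.2 k2)
    have := mul_le_mul_of_nonneg_left hlog hL'.le
    nlinarith
  · have := key _ _ (sub_pos.2 h3) (sub_pos.2 k3)
    have e : a * (1 - z.im) + b * (1 - w.im) = 1 - (a * z.im + b * w.im) := by
      subst hb'; ring
    linarith

lemma logContour_isOpen (L' R₀ : ℝ) (hR₀ : 1 < R₀) :
    IsOpen {z : ℂ | R₀ < z.re ∧ -L' * Real.log z.re < z.im ∧ z.im < 1} := by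
  rw [isOpen_iff_mem_nhds]
  rintro z ⟨h1, h2, h3⟩
  have c1 : ContinuousAt (fun z : ℂ => z.re) z := Complex.continuous_re.continuousAt
  have c2 : ContinuousAt (fun z : ℂ => z.im) z := Complex.continuous_im.continuousAt
  have c3 : ContinuousAt (fun z : ℂ => -L' * Real.log z.re) z :=
    (c1.log (by linarith)).const_mul _
  filter_upwards [c1.eventually_const_lt h1, c3.eventually_lt c2 h2,
    c2.eventually_lt_const h3] with w a b c using ⟨a, b, c⟩

lemma logContour_aux {B : Type*} [NormedAddCommGroup B] [NormedSpace ℂ B] [CompleteSpace B]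
    (L L' C R₀ R : ℝ) (hL : 0 < L) (hLL' : L < L') (hC : 0 < C)
    (hR₀ : 1 < R₀) (hR : R₀ < R) (f : ℂ → B)
    (hf : DifferentiableOn ℂ f
      {z : ℂ | R₀ < z.re ∧ -L' * Real.log z.re < z.im ∧ z.im < 1})
    (hb : ∀ z : ℂ, R₀ < z.re → -L' * Real.log z.re < z.im → z.im ≤ 0 →
      ‖f z‖ ≤ C * z.re ^ (-2 : ℝ)) :
      IntegrableOn (fun σ : ℝ => f (σ : ℂ)) (Ioi R) ∧
      IntegrableOn (fun y : ℝ => f ((R : ℂ) - Complex.I * (y : ℂ))) (Ioc 0 (L * Real.log R)) ∧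
      IntegrableOn (fun σ : ℝ => (1 - Complex.I * (L : ℂ) / (σ : ℂ)) •
          f ((σ : ℂ) - Complex.I * ((L * Real.log σ : ℝ) : ℂ))) (Ioi R) ∧
      (∫ σ in Ioi R, f (σ : ℂ))
        = (-Complex.I) • (∫ y in Ioc (0 : ℝ) (L * Real.log R),
                f ((R : ℂ) - Complex.I * (y : ℂ)))
          + ∫ σ in Ioi R, (1 - Complex.I * (L : ℂ) / (σ : ℂ)) •
                f ((σ : ℂ) - Complex.I * ((L * Real.log σ : ℝ) : ℂ)) := by
  set Ω := {z : ℂ | R₀ < z.re ∧ -L' * Real.log z.re < z.im ∧ z.im < 1} with hΩ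
  have hopen : IsOpen Ω := logContour_isOpen L' R₀ hR₀
  obtain ⟨F, hF'⟩ := (logContour_convex L' R₀ (hL.trans hLL') hR₀).exists_forall_hasDerivWithinAt hf
  have hF : ∀ z ∈ Ω, HasDerivAt F (f z) z := fun z hz => (hF' z hz).hasDerivAt (hopen.mem_nhds hz)
  -- membership
  have hlogpos : ∀ σ : ℝ, R ≤ σ → 0 < Real.log σ := fun σ h => Real.log_pos (by linarith)
  have hmem : ∀ σ y : ℝ, R ≤ σ → 0 ≤ y → y ≤ L * Real.log σ →
      ((σ : ℂ) - Complex.I * (y : ℂ)) ∈ Ω := by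
    intro σ y h1 h2 h3
    have := hlogpos σ h1
    have := mul_lt_mul_of_pos_right hLL' this
    simp only [hΩ, mem_ofPred_eq]
    simp
    refine ⟨by linarith, by linarith, by linarith⟩
  have hbd : ∀ σ y : ℝ, R ≤ σ → 0 ≤ y → y ≤ L * Real.log σ →
      ‖f ((σ : ℂ) - Complex.I * (y : ℂ))‖ ≤ C * σ ^ (-2 : ℝ) := by
    intro σ y h1 h2 h3
    obtain ⟨a, b, c⟩ := hmem σ y h1 h2 h3
    have := hb _ a b (by simpa using h2)
    simpa using this
  have hmem0 : ∀ σ : ℝ, R ≤ σ → (σ : ℂ) ∈ Ω := by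
    intro σ h
    have := hmem σ 0 h le_rfl (mul_pos hL (hlogpos σ h)).le
    simpa using this
  have hbd0 : ∀ σ : ℝ, R ≤ σ → ‖f (σ : ℂ)‖ ≤ C * σ ^ (-2 : ℝ) := by
    intro σ h
    have := hbd σ 0 h le_rfl (mul_pos hL (hlogpos σ h)).le
    simpa using this
  have hmemL : ∀ σ : ℝ, R ≤ σ → ((σ : ℂ) - Complex.I * ((L * Real.log σ : ℝ) : ℂ)) ∈ Ω :=
    fun σ h => hmem σ _ h (mul_pos hL (hlogpos σ h)).le le_rfl
  have hfc : ContinuousOn f Ω := hf.continuousOn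
  -- continuity
  have hc1 : ContinuousOn (fun σ : ℝ => f (σ : ℂ)) (Ici R) :=
    hfc.comp (by fun_prop) (fun σ h => hmem0 σ h)
  have hlR := mul_pos hL (hlogpos R le_rfl)
  have hc2 : ContinuousOn (fun y : ℝ => f ((R : ℂ) - Complex.I * (y : ℂ)))
      (Icc 0 (L * Real.log R)) :=
    hfc.comp (by fun_prop) (fun y h => hmem R y le_rfl h.1 h.2)
  have hclog : ContinuousOn (fun σ : ℝ => Real.log σ) (Ici R) :=
    Real.continuousOn_log.mono (fun σ h => by
      have : R ≤ σ := h
      simp; linarith)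
  have hc3 : ContinuousOn (fun σ : ℝ => (1 - Complex.I * (L : ℂ) / (σ : ℂ)) •
          f ((σ : ℂ) - Complex.I * ((L * Real.log σ : ℝ) : ℂ))) (Ici R) := by
    refine ContinuousOn.smul ?_ (hfc.comp ?_ (fun σ h => hmemL σ h))
    · refine continuousOn_const.sub (continuousOn_const.div (by fun_prop) ?_)
      intro σ h
      have : R ≤ σ := h
      have : σ ≠ 0 := by linarith
      exact_mod_cast this
    · refine ContinuousOn.sub (by fun_prop) (continuousOn_const.mul ?_)
      exact Complex.continuous_ofReal.comp_continuousOn (continuousOn_const.mul hclog)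
  have hpow : IntegrableOn (fun σ : ℝ => σ ^ (-2 : ℝ)) (Ioi R) :=
    integrableOn_Ioi_rpow_of_lt (by norm_num) (by linarith)
  have hi1 : IntegrableOn (fun σ : ℝ => f (σ : ℂ)) (Ioi R) := by
    refine Integrable.mono' (hpow.const_mul C)
      ((hc1.mono Ioi_subset_Ici_self).aestronglyMeasurable measurableSet_Ioi) ?_
    refine (ae_restrict_iff' measurableSet_Ioi).2 (ae_of_all _ fun σ h => hbd0 σ (le_of_lt h))
  have hi2 : IntegrableOn (fun y : ℝ => f ((R : ℂ) - Complex.I * (y : ℂ)))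
      (Ioc 0 (L * Real.log R)) :=
    hc2.integrableOn_Icc.mono_set Ioc_subset_Icc_self
  have hi3 : IntegrableOn (fun σ : ℝ => (1 - Complex.I * (L : ℂ) / (σ : ℂ)) •
          f ((σ : ℂ) - Complex.I * ((L * Real.log σ : ℝ) : ℂ))) (Ioi R) := by
    refine Integrable.mono' (hpow.const_mul ((1 + L) * C))
      ((hc3.mono Ioi_subset_Ici_self).aestronglyMeasurable measurableSet_Ioi) ?_
    refine (ae_restrict_iff' measurableSet_Ioi).2 (ae_of_all _ fun σ h => ?_)
    have h' : R ≤ σ := le_of_lt h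
    rw [norm_smul, mul_assoc]
    refine mul_le_mul ?_ (hbd σ _ h' (mul_pos hL (hlogpos σ h')).le le_rfl)
      (norm_nonneg _) (by linarith)
    refine (norm_sub_le _ _).trans ?_
    have hσ : 1 ≤ σ := by linarith
    simp only [norm_one, norm_div, norm_mul, Complex.norm_I, Complex.norm_real, one_mul,
      Real.norm_eq_abs, abs_of_pos hL, abs_of_pos (show 0 < σ by linarith)]
    have := div_le_self hL.le hσ
    linarith
  refine ⟨hi1, hi2, hi3, ?_⟩
  -- FTC
  have f1 : ∀ S : ℝ, R ≤ S → ∫ σ in R..S, f (σ : ℂ) = F S - F R := by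
    intro S hS
    refine intervalIntegral.integral_eq_sub_of_hasDerivAt
      (f := fun σ : ℝ => F (σ : ℂ)) ?_ ?_
    · intro σ h
      rw [uIcc_of_le hS] at h
      have := (hF _ (hmem0 σ h.1)).scomp σ (Complex.ofRealCLM.hasDerivAt (x := σ))
      simpa [Function.comp_def] using this
    · exact (hc1.mono (by rw [uIcc_of_le hS]; exact Icc_subset_Ici_self)).intervalIntegrable
  have f2 : ∀ S : ℝ, R ≤ S → ∀ y : ℝ, 0 ≤ y → y ≤ L * Real.log S →
      HasDerivAt (fun y : ℝ => F ((S : ℂ) - Complex.I * (y : ℂ)))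
        ((-Complex.I) • f ((S : ℂ) - Complex.I * (y : ℂ))) y := by
    intro S hS y h0 h1
    have hd : HasDerivAt (fun y : ℝ => (S : ℂ) - Complex.I * (y : ℂ)) (-Complex.I) y := by
      have := ((Complex.ofRealCLM.hasDerivAt (x := y)).const_mul Complex.I).const_sub (S : ℂ)
      simpa using this
    exact (hF _ (hmem S y hS h0 h1)).scomp y hd
  have f2' : (-Complex.I) • (∫ y in (0:ℝ)..(L * Real.log R), f ((R : ℂ) - Complex.I * (y : ℂ)))
      = F ((R : ℂ) - Complex.I * ((L * Real.log R : ℝ) : ℂ)) - F R := by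
    rw [← intervalIntegral.integral_smul]
    have := intervalIntegral.integral_eq_sub_of_hasDerivAt
      (f := fun y : ℝ => F ((R : ℂ) - Complex.I * (y : ℂ)))
      (f' := fun y : ℝ => (-Complex.I) • f ((R : ℂ) - Complex.I * (y : ℂ)))
      (a := 0) (b := L * Real.log R) ?_ ?_
    · simpa using this
    · intro y h
      rw [uIcc_of_le hlR.le] at h
      exact f2 R le_rfl y h.1 h.2
    · refine ContinuousOn.intervalIntegrable ?_
      rw [uIcc_of_le hlR.le]
      exact continuousOn_const.smul hc2
  have f3 : ∀ S : ℝ, R ≤ S → ∫ σ in R..S, (1 - Complex.I * (L : ℂ) / (σ : ℂ)) •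
          f ((σ : ℂ) - Complex.I * ((L * Real.log σ : ℝ) : ℂ))
      = F ((S : ℂ) - Complex.I * ((L * Real.log S : ℝ) : ℂ))
        - F ((R : ℂ) - Complex.I * ((L * Real.log R : ℝ) : ℂ)) := by
    intro S hS
    refine intervalIntegral.integral_eq_sub_of_hasDerivAt
      (f := fun σ : ℝ => F ((σ : ℂ) - Complex.I * ((L * Real.log σ : ℝ) : ℂ))) ?_ ?_
    · intro σ h
      rw [uIcc_of_le hS] at h
      have hσ : σ ≠ 0 := by linarith [h.1]
      have hd : HasDerivAt (fun σ : ℝ => (σ : ℂ) - Complex.I * ((L * Real.log σ : ℝ) : ℂ))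
          (1 - Complex.I * (L : ℂ) / (σ : ℂ)) σ := by
        have h1 := ((Real.hasDerivAt_log hσ).const_mul L).ofReal_comp
        have h2 := (Complex.ofRealCLM.hasDerivAt (x := σ)).sub (h1.const_mul Complex.I)
        refine h2.congr_deriv ?_
        simp [div_eq_mul_inv, mul_assoc]
      exact (hF _ (hmemL σ h.1)).scomp σ hd
    · exact (hc3.mono (by rw [uIcc_of_le hS]; exact Icc_subset_Ici_self)).intervalIntegrable
  -- closing side
  have f4 : ∀ S : ℝ, R ≤ S →
      ‖F ((S : ℂ) - Complex.I * ((L * Real.log S : ℝ) : ℂ)) - F S‖ ≤ C * L * S⁻¹ := by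
    intro S hS
    have hS0 : 0 < S := by linarith
    have hlS := mul_pos hL (hlogpos S hS)
    have := norm_image_sub_le_of_norm_deriv_le_segment'
      (f := fun y : ℝ => F ((S : ℂ) - Complex.I * (y : ℂ)))
      (f' := fun y : ℝ => (-Complex.I) • f ((S : ℂ) - Complex.I * (y : ℂ)))
      (C := C * S ^ (-2 : ℝ)) (a := 0) (b := L * Real.log S)
      (fun y h => (f2 S hS y h.1 h.2).hasDerivWithinAt)
      (fun y h => by
        rw [norm_smul, norm_neg, Complex.norm_I, one_mul]
        exact hbd S y hS h.1 h.2.le) (L * Real.log S) ⟨hlS.le, le_rfl⟩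
    simp only [Complex.ofReal_zero, mul_zero, sub_zero] at this
    refine this.trans ?_
    have e : S ^ (-2 : ℝ) = S⁻¹ * S⁻¹ := by
      rw [Real.rpow_neg hS0.le]; norm_num; rw [sq, mul_inv]
    have hl : Real.log S ≤ S := (Real.log_le_sub_one_of_pos hS0).trans (by linarith)
    have h1 : S⁻¹ * Real.log S ≤ 1 := by
      rw [inv_mul_le_iff₀ hS0]; linarith
    calc C * S ^ (-2 : ℝ) * (L * Real.log S) = C * L * S⁻¹ * (S⁻¹ * Real.log S) := by
          rw [e]; ring
      _ ≤ C * L * S⁻¹ * 1 := by gcongr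
      _ = _ := by ring
  have t4 : Filter.Tendsto (fun S : ℝ =>
      F ((S : ℂ) - Complex.I * ((L * Real.log S : ℝ) : ℂ)) - F S) Filter.atTop (nhds 0) := by
    have h0 : Filter.Tendsto (fun S : ℝ => C * L * S⁻¹) Filter.atTop (nhds 0) := by
      simpa using tendsto_inv_atTop_zero.const_mul (C * L)
    refine squeeze_zero_norm' ?_ h0
    filter_upwards [Filter.eventually_ge_atTop R] with S hS using f4 S hS
  have t1 := intervalIntegral_tendsto_integral_Ioi R hi1 Filter.tendsto_id
  have t3 := intervalIntegral_tendsto_integral_Ioi R hi3 Filter.tendsto_id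
  have t5 := (t3.const_add ((-Complex.I) • (∫ y in (0:ℝ)..(L * Real.log R),
    f ((R : ℂ) - Complex.I * (y : ℂ))))).sub t4
  rw [sub_zero, intervalIntegral.integral_of_le hlR.le] at t5
  refine tendsto_nhds_unique t1 (t5.congr' ?_)
  filter_upwards [Filter.eventually_ge_atTop R] with S hS
  rw [← intervalIntegral.integral_of_le hlR.le, f2']
  simp only [id]
  rw [f1 S hS, f3 S hS]
  abel

/-- Deformation of the real-axis integral `∫_R^∞ e^{−itσ} g(σ) dσ` onto a
vertical segment plus the logarithmic contour `{σ − iL log σ : σ ≥ R}`, valid for `t ≥ T`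
when `g` is holomorphic with bound `C (Re λ)^{−2} e^{T|Im λ|}` on the logarithmic region
`Ω = {Re λ > R₀, −L' log(Re λ) < Im λ < 1}`. -/
theorem log_contour_deformation
    {B : Type*} [NormedAddCommGroup B] [NormedSpace ℂ B] [CompleteSpace B]
    (L L' T C R₀ R : ℝ) (hL : 0 < L) (hLL' : L < L') (hT : 0 ≤ T) (hC : 0 < C)
    (hR₀ : 1 < R₀) (hR : R₀ < R)
    (g : ℂ → B)
    (hgHol : DifferentiableOn ℂ g
      {z : ℂ | R₀ < z.re ∧ -L' * Real.log z.re < z.im ∧ z.im < 1})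
    (hgBound : ∀ z : ℂ, R₀ < z.re → -L' * Real.log z.re < z.im → z.im < 1 →
      ‖g z‖ ≤ C * z.re ^ (-2 : ℤ) * Real.exp (T * |z.im|)) :
    ∀ t : ℝ, T ≤ t →
      IntegrableOn (fun σ : ℝ =>
        Complex.exp (-Complex.I * (t : ℂ) * (σ : ℂ)) • g (σ : ℂ)) (Ioi R) ∧
      IntegrableOn (fun y : ℝ =>
        Complex.exp (-Complex.I * (t : ℂ) * ((R : ℂ) - Complex.I * (y : ℂ))) •
          g ((R : ℂ) - Complex.I * (y : ℂ))) (Ioc 0 (L * Real.log R)) ∧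
      IntegrableOn (fun σ : ℝ =>
        (Complex.exp (-Complex.I * (t : ℂ) *
            ((σ : ℂ) - Complex.I * ((L * Real.log σ : ℝ) : ℂ))) *
          (1 - Complex.I * (L : ℂ) / (σ : ℂ))) •
          g ((σ : ℂ) - Complex.I * ((L * Real.log σ : ℝ) : ℂ))) (Ioi R) ∧
      (∫ σ in Ioi R, Complex.exp (-Complex.I * (t : ℂ) * (σ : ℂ)) • g (σ : ℂ))
        = (-Complex.I) • (∫ y in Ioc (0 : ℝ) (L * Real.log R),
              Complex.exp (-Complex.I * (t : ℂ) * ((R : ℂ) - Complex.I * (y : ℂ))) •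
                g ((R : ℂ) - Complex.I * (y : ℂ)))
          + ∫ σ in Ioi R,
              (Complex.exp (-Complex.I * (t : ℂ) *
                  ((σ : ℂ) - Complex.I * ((L * Real.log σ : ℝ) : ℂ))) *
                (1 - Complex.I * (L : ℂ) / (σ : ℂ))) •
                g ((σ : ℂ) - Complex.I * ((L * Real.log σ : ℝ) : ℂ)) := by
  intro t ht
  have hdiff : DifferentiableOn ℂ (fun z : ℂ => Complex.exp (-Complex.I * (t : ℂ) * z) • g z)
      {z : ℂ | R₀ < z.re ∧ -L' * Real.log z.re < z.im ∧ z.im < 1} :=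
    DifferentiableOn.smul (by fun_prop) hgHol
  have hbd : ∀ z : ℂ, R₀ < z.re → -L' * Real.log z.re < z.im → z.im ≤ 0 →
      ‖Complex.exp (-Complex.I * (t : ℂ) * z) • g z‖ ≤ C * z.re ^ (-2 : ℝ) := by
    intro z h1 h2 h3
    have h := hgBound z h1 h2 (by linarith)
    have e0 : z.re ^ (-2 : ℝ) = z.re ^ (-2 : ℤ) := by
      rw [← Real.rpow_intCast]; norm_num
    have hp : 0 < C * z.re ^ (-2 : ℤ) := mul_pos hC (zpow_pos (by linarith) _)
    rw [norm_smul, Complex.norm_exp, e0]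
    have e1 : (-Complex.I * (t : ℂ) * z).re = t * z.im := by simp
    rw [e1]
    calc Real.exp (t * z.im) * ‖g z‖
        ≤ Real.exp (t * z.im) * (C * z.re ^ (-2 : ℤ) * Real.exp (T * |z.im|)) := by gcongr
      _ = C * z.re ^ (-2 : ℤ) * Real.exp (t * z.im + T * |z.im|) := by
          rw [Real.exp_add]; ring
      _ ≤ C * z.re ^ (-2 : ℤ) * 1 := by
          gcongr
          rw [Real.exp_le_one_iff, abs_of_nonpos h3]
          nlinarith
      _ = _ := mul_one _
  have main := logContour_aux L L' C R₀ R hL hLL' hC hR₀ hR _ hdiff hbd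
  have e : ∀ σ : ℝ, (Complex.exp (-Complex.I * (t : ℂ) *
            ((σ : ℂ) - Complex.I * ((L * Real.log σ : ℝ) : ℂ))) *
          (1 - Complex.I * (L : ℂ) / (σ : ℂ))) •
          g ((σ : ℂ) - Complex.I * ((L * Real.log σ : ℝ) : ℂ)) =
        (1 - Complex.I * (L : ℂ) / (σ : ℂ)) • (Complex.exp (-Complex.I * (t : ℂ) *
            ((σ : ℂ) - Complex.I * ((L * Real.log σ : ℝ) : ℂ))) •
          g ((σ : ℂ) - Complex.I * ((L * Real.log σ : ℝ) : ℂ))) := by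
    intro σ
    rw [smul_smul, mul_comm]
  simp only [e]
  exact main
end

section
/- Let B be a complex Banach space, L > 0, T ≥ 0, M ∈ ℝ, C > 0 and R > 1, and let g be a continuous B-valued function on the logarithmic contour {σ − iL log σ : σ ≥ R} satisfying ‖g(σ − iL log σ)‖ ≤ C σ^M e^{T L log σ} for all σ ≥ R. If t ∈ ℝ satisfies (t − T)L > M + 1, then ∫_R^∞ ‖e^{−it(σ − iL log σ)} g(σ − iL log σ)(1 − iL/σ)‖ dσ ≤ C(1+L) · R^{M+1−(t−T)L} / ((t−T)L − M − 1); in particular the contour integral ∫_R^∞ e^{−it(σ − iL log σ)} g(σ − iL log σ)(1 − iL/σ) dσ converges absolutely in B. -/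
open MeasureTheory Set

/-- Quantitative convergence on the logarithmic contour: if
`‖g(σ − iL log σ)‖ ≤ C σ^M e^{TL log σ}` for `σ ≥ R` and `(t−T)L > M+1`, then
`∫_R^∞ ‖e^{−it(σ − iL log σ)} g(σ − iL log σ)(1 − iL/σ)‖ dσ
  ≤ C(1+L)·R^{M+1−(t−T)L}/((t−T)L − M − 1)`, and the contour integral converges
absolutely. -/
theorem log_contour_integral_estimate
    {B : Type*} [NormedAddCommGroup B] [NormedSpace ℂ B] [CompleteSpace B]
    (L T M C R : ℝ) (hL : 0 < L) (hT : 0 ≤ T) (hC : 0 < C) (hR : 1 < R)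
    (g : ℂ → B)
    (hgCont : ContinuousOn
      (fun σ : ℝ => g ((σ : ℂ) - Complex.I * ((L * Real.log σ : ℝ) : ℂ))) (Ici R))
    (hgBound : ∀ σ : ℝ, R ≤ σ →
      ‖g ((σ : ℂ) - Complex.I * ((L * Real.log σ : ℝ) : ℂ))‖
        ≤ C * σ ^ M * Real.exp (T * L * Real.log σ))
    (t : ℝ) (ht : M + 1 < (t - T) * L) :
    (∫ σ in Ioi R,
        ‖(Complex.exp (-Complex.I * (t : ℂ) *
              ((σ : ℂ) - Complex.I * ((L * Real.log σ : ℝ) : ℂ))) *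
            (1 - Complex.I * (L : ℂ) / (σ : ℂ))) •
            g ((σ : ℂ) - Complex.I * ((L * Real.log σ : ℝ) : ℂ))‖)
      ≤ C * (1 + L) * R ^ (M + 1 - (t - T) * L) / ((t - T) * L - M - 1) ∧
    IntegrableOn (fun σ : ℝ =>
      (Complex.exp (-Complex.I * (t : ℂ) *
          ((σ : ℂ) - Complex.I * ((L * Real.log σ : ℝ) : ℂ))) *
        (1 - Complex.I * (L : ℂ) / (σ : ℂ))) •
        g ((σ : ℂ) - Complex.I * ((L * Real.log σ : ℝ) : ℂ))) (Ioi R) := by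
  have hR0 : 0 < R := by linarith
  have ha : M - (t - T) * L < -1 := by linarith
  have hb : ∀ σ ∈ Ioi R, ‖(Complex.exp (-Complex.I * (t : ℂ) *
          ((σ : ℂ) - Complex.I * ((L * Real.log σ : ℝ) : ℂ))) *
        (1 - Complex.I * (L : ℂ) / (σ : ℂ))) •
        g ((σ : ℂ) - Complex.I * ((L * Real.log σ : ℝ) : ℂ))‖
        ≤ C * (1 + L) * σ ^ (M - (t - T) * L) := by
    intro σ hσ
    have hσR : R < σ := hσ
    have hσ0 : 0 < σ := by linarith
    have h1 : ‖Complex.exp (-Complex.I * (t : ℂ) *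
          ((σ : ℂ) - Complex.I * ((L * Real.log σ : ℝ) : ℂ)))‖
        = Real.exp (-(t * L * Real.log σ)) := by
      rw [Complex.norm_exp]
      congr 1
      simp only [Complex.mul_re, Complex.mul_im, Complex.sub_re, Complex.sub_im,
        Complex.neg_re, Complex.neg_im, Complex.I_re, Complex.I_im,
        Complex.ofReal_re, Complex.ofReal_im]
      ring
    have h2 : ‖(1 - Complex.I * (L : ℂ) / (σ : ℂ))‖ ≤ 1 + L := by
      refine (norm_sub_le _ _).trans ?_
      have h3 : ‖Complex.I * (L : ℂ) / (σ : ℂ)‖ = L / σ := by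
        simp [abs_of_pos hL, abs_of_pos hσ0]
      rw [h3, norm_one]
      have : L / σ ≤ L := div_le_self hL.le (by linarith)
      linarith
    rw [norm_smul, norm_mul, h1]
    have h4 : σ ^ (M - (t - T) * L) = Real.exp (-(t * L * Real.log σ)) *
        (σ ^ M * Real.exp (T * L * Real.log σ)) := by
      rw [Real.rpow_def_of_pos hσ0, Real.rpow_def_of_pos hσ0, ← Real.exp_add, ← Real.exp_add]
      congr 1
      ring
    calc _ ≤ Real.exp (-(t * L * Real.log σ)) * (1 + L) *
          (C * σ ^ M * Real.exp (T * L * Real.log σ)) := by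
            gcongr
            exact hgBound σ hσR.le
      _ = _ := by rw [h4]; ring
  have hint : IntegrableOn (fun σ : ℝ => C * (1 + L) * σ ^ (M - (t - T) * L)) (Ioi R) :=
    (integrableOn_Ioi_rpow_of_lt ha hR0).const_mul _
  have hne : ∀ σ ∈ Ioi R, σ ≠ 0 := fun σ hσ => (hR0.trans hσ).ne'
  have hneC : ∀ σ ∈ Ioi R, (σ : ℂ) ≠ 0 := fun σ hσ => by exact_mod_cast hne σ hσ
  have hlog : ContinuousOn (fun σ : ℝ => ((L * Real.log σ : ℝ) : ℂ)) (Ioi R) :=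
    Complex.continuous_ofReal.comp_continuousOn
      (continuousOn_const.mul (continuousOn_id.log hne))
  have hid : ContinuousOn (fun σ : ℝ => (σ : ℂ)) (Ioi R) :=
    Complex.continuous_ofReal.continuousOn
  have hI : IntegrableOn (fun σ : ℝ =>
      (Complex.exp (-Complex.I * (t : ℂ) *
          ((σ : ℂ) - Complex.I * ((L * Real.log σ : ℝ) : ℂ))) *
        (1 - Complex.I * (L : ℂ) / (σ : ℂ))) •
        g ((σ : ℂ) - Complex.I * ((L * Real.log σ : ℝ) : ℂ))) (Ioi R) := by
    refine Integrable.mono' hint ?_ ((ae_restrict_iff' measurableSet_Ioi).2 (.of_forall hb))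
    refine ContinuousOn.aestronglyMeasurable ?_ measurableSet_Ioi
    refine ContinuousOn.smul (ContinuousOn.mul ?_ ?_) (hgCont.mono Ioi_subset_Ici_self)
    · exact (continuousOn_const.mul (hid.sub (continuousOn_const.mul hlog))).cexp
    · exact continuousOn_const.sub (continuousOn_const.div hid hneC)
  refine ⟨?_, hI⟩
  refine (setIntegral_mono_on hI.norm hint measurableSet_Ioi hb).trans_eq ?_
  rw [integral_const_mul, integral_Ioi_rpow_of_lt ha hR0,
    show M - (t - T) * L + 1 = M + 1 - (t - T) * L by ring, neg_div, ← div_neg, mul_div_assoc]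
  congr 2
  ring
end

section
/- Let B be a complex Banach space, let L' > L > 0, T ≥ 0, C > 0, and 1 < R₀ < R. Suppose g is holomorphic on Ω := {λ ∈ ℂ : Re λ > R₀, −L' log(Re λ) < Im λ < 1} with values in B and satisfies ‖g(λ)‖ ≤ C (Re λ)^{−2} e^{T|Im λ|} for all λ ∈ Ω. Define u(t) := ∫_R^∞ e^{−itσ} g(σ) dσ for t ∈ ℝ (an absolutely convergent Bochner integral). Then for every integer N ≥ 0, the function u is N times continuously differentiable on the open interval (T + (N+1)/L, ∞), and for every ε > 0, sup{ ‖u^{(N)}(t)‖ : t ≥ T + (N+1+ε)/L } < ∞. -/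
open MeasureTheory Set

namespace LogRegion

/-- The region. -/
def Om (L' R₀ : ℝ) : Set ℂ := {z : ℂ | R₀ < z.re ∧ -L' * Real.log z.re < z.im ∧ z.im < 1}

/-- The contour. -/
noncomputable def ga (L R : ℝ) (σ : ℝ) : ℂ := (σ : ℂ) - Complex.I * ((L * Real.log (σ / R) : ℝ) : ℂ)

/-- Its derivative. -/
noncomputable def ga' (L : ℝ) (σ : ℝ) : ℂ := 1 - Complex.I * ((L / σ : ℝ) : ℂ)

lemma ga_re (L R σ : ℝ) : (ga L R σ).re = σ := by simp [ga]
lemma ga_im (L R σ : ℝ) : (ga L R σ).im = -(L * Real.log (σ / R)) := by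
  simp only [ga, Complex.sub_im, Complex.ofReal_im, Complex.I_mul_im, Complex.ofReal_re]; ring

lemma Om_convex (L' R₀ : ℝ) (hL' : 0 < L') (hR₀ : 1 < R₀) : Convex ℝ (Om L' R₀) := by
  intro z hz w hw a b ha hb hab
  obtain ⟨h1, h2, h3⟩ := hz
  obtain ⟨k1, k2, k3⟩ := hw
  have hlog := strictConcaveOn_log_Ioi.concaveOn.2 (show z.re ∈ Ioi (0:ℝ) from by simp; linarith)
    (show w.re ∈ Ioi (0:ℝ) from by simp; linarith) ha hb hab
  simp only [smul_eq_mul] at hlog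
  have hb' : b = 1 - a := by linarith
  have key : ∀ {p q r : ℝ}, r < p → r < q → r < a * p + b * q := by
    intro p q r hp hq
    rcases ha.eq_or_lt with h | h
    · subst h; have : b = 1 := by linarith
      subst this; linarith
    · subst hb'; nlinarith
  refine ⟨?_, ?_, ?_⟩
  · simpa using key h1 k1
  · have := key (p := z.im + L' * Real.log z.re) (q := w.im + L' * Real.log w.re) (r := 0)
      (by linarith) (by linarith)
    simp only [Complex.add_re, Complex.add_im, Complex.real_smul, Complex.re_ofReal_mul,
      Complex.im_ofReal_mul]
    nlinarith
  · have := key (p := -z.im) (q := -w.im) (r := -1) (by linarith) (by linarith)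
    simp only [Complex.add_im, Complex.real_smul, Complex.im_ofReal_mul]
    linarith

lemma Om_open (L' R₀ : ℝ) (hR₀ : 1 < R₀) : IsOpen (Om L' R₀) := by
  have h1 : IsOpen {z : ℂ | R₀ < z.re ∧ z.im < 1} :=
    (isOpen_lt continuous_const Complex.continuous_re).inter
      (isOpen_lt Complex.continuous_im continuous_const)
  have h2 : ContinuousOn (fun z : ℂ => z.im + L' * Real.log z.re) {z : ℂ | R₀ < z.re ∧ z.im < 1} := by
    refine Complex.continuous_im.continuousOn.add (continuousOn_const.mul ?_)
    refine Complex.continuous_re.continuousOn.log ?_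
    intro z hz
    have := hz.1
    linarith
  have := h2.isOpen_inter_preimage h1 (isOpen_Ioi (a := (0:ℝ)))
  convert this using 1
  ext z
  simp only [Om, mem_ofPred_eq, mem_inter_iff, mem_preimage, mem_Ioi]
  constructor
  · rintro ⟨a, b, c⟩; exact ⟨⟨a, c⟩, by linarith⟩
  · rintro ⟨⟨a, c⟩, b⟩; exact ⟨a, by linarith, c⟩

/-- points between the axis and the contour -/
lemma seg_mem (L L' R₀ R : ℝ) (hL : 0 < L) (hLL' : L < L') (hR₀ : 1 < R₀) (hR : R₀ < R)
    (z : ℂ) (h1 : R ≤ z.re) (h2 : -(L * Real.log (z.re / R)) ≤ z.im) (h3 : z.im ≤ 0) :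
    z ∈ Om L' R₀ := by
  refine ⟨by linarith, ?_, by linarith⟩
  have hl : Real.log (z.re / R) = Real.log z.re - Real.log R :=
    Real.log_div (by linarith) (by linarith)
  have h4 : 0 < Real.log R := Real.log_pos (by linarith)
  have h5 : 0 < Real.log z.re := Real.log_pos (by linarith)
  rw [hl] at h2
  nlinarith

lemma log_nn {R σ : ℝ} (hR : 1 < R) (h : R ≤ σ) : 0 ≤ Real.log (σ / R) :=
  Real.log_nonneg (by rw [le_div_iff₀ (by linarith)]; linarith)

lemma log_le {R σ : ℝ} (hR : 1 < R) (h : R ≤ σ) : Real.log (σ / R) ≤ σ := by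
  have h0 : 0 < σ / R := by apply div_pos <;> linarith
  have := Real.log_le_sub_one_of_pos h0
  have : σ / R ≤ σ := div_le_self (by linarith) hR.le
  linarith

lemma ga_mem (L L' R₀ R : ℝ) (hL : 0 < L) (hLL' : L < L') (hR₀ : 1 < R₀) (hR : R₀ < R)
    (σ : ℝ) (h : R ≤ σ) : ga L R σ ∈ Om L' R₀ := by
  have := log_nn (by linarith) h
  apply seg_mem L L' R₀ R hL hLL' hR₀ hR
  · rwa [ga_re]
  · rw [ga_re, ga_im]
  · rw [ga_im]; have := mul_nonneg hL.le this; linarith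

lemma real_mem (L' R₀ R : ℝ) (hL' : 0 < L') (hR₀ : 1 < R₀) (hR : R₀ < R)
    (σ : ℝ) (h : R ≤ σ) : (σ : ℂ) ∈ Om L' R₀ := by
  refine ⟨by simp; linarith, ?_, by simp⟩
  have : 0 < Real.log σ := Real.log_pos (by linarith)
  simp only [Complex.ofReal_re, Complex.ofReal_im]
  nlinarith

lemma ga_deriv (L R : ℝ) (hR : 1 < R) (σ : ℝ) (h : R ≤ σ) : HasDerivAt (ga L R) (ga' L σ) σ := by
  have h0 : HasDerivAt (fun σ : ℝ => L * Real.log (σ / R)) (L / σ) σ := by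
    have := (((hasDerivAt_id σ).div_const R).log (by
      have : 0 < σ / R := div_pos (by linarith) (by linarith)
      simpa using this.ne')).const_mul L
    refine this.congr_deriv ?_
    have : σ ≠ 0 := by linarith
    have : R ≠ 0 := by linarith
    simp only [id]
    field_simp
  exact ((hasDerivAt_id σ).ofReal_comp).sub (h0.ofReal_comp.const_mul Complex.I)

lemma ga_norm (L R : ℝ) (hL : 0 < L) (hR : 1 < R) (σ : ℝ) (h : R ≤ σ) :
    ‖ga L R σ‖ ≤ (1 + L) * σ := by
  have h1 := log_nn hR h
  have h2 := log_le hR h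
  calc ‖ga L R σ‖ ≤ |σ| + |L * Real.log (σ / R)| := by
        refine (norm_sub_le _ _).trans ?_
        rw [norm_mul, Complex.norm_I, one_mul, Complex.norm_real, Complex.norm_real]
        rfl
    _ = σ + L * Real.log (σ / R) := by
        rw [abs_of_nonneg (by linarith), abs_of_nonneg (by positivity)]
    _ ≤ _ := by nlinarith

lemma ga'_norm (L R : ℝ) (hL : 0 < L) (hR : 1 < R) (σ : ℝ) (h : R ≤ σ) : ‖ga' L σ‖ ≤ 1 + L := by
  have h0 : 0 < σ := by linarith
  calc ‖ga' L σ‖ ≤ 1 + |L / σ| := by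
        refine (norm_sub_le _ _).trans ?_
        rw [norm_mul, Complex.norm_I, one_mul, Complex.norm_real, norm_one]
        rfl
    _ = 1 + L / σ := by rw [abs_of_nonneg (by positivity)]
    _ ≤ _ := by
      have : L / σ ≤ L := div_le_self hL.le (by linarith)
      linarith

lemma exp_norm (t : ℝ) (z : ℂ) : ‖Complex.exp (-Complex.I * t * z)‖ = Real.exp (t * z.im) := by
  rw [Complex.norm_exp]
  congr 1
  simp [Complex.mul_re, Complex.mul_im]

lemma integrable_pow (R : ℝ) (hR : 1 < R) (K : ℝ) :
    IntegrableOn (fun σ : ℝ => K * σ ^ (-2 : ℤ)) (Ioi R) := by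
  have := (integrableOn_Ioi_rpow_of_lt (a := -2) (by norm_num) (c := R) (by linarith)).const_mul K
  refine IntegrableOn.congr_fun (f := fun x : ℝ => K * x ^ (-2 : ℝ)) this ?_ measurableSet_Ioi
  intro x hx
  simp only
  rw [← Real.rpow_intCast]; norm_num

/-- abstract differentiation lemma -/
lemma abstract_smooth {B : Type*} [NormedAddCommGroup B] [NormedSpace ℝ B]
    (u : ℝ → B) (v : ℕ → ℝ → B) (a : ℝ) (N : ℕ) (h0 : ∀ t, a < t → u t = v 0 t)
    (hd : ∀ k ≤ N, ∀ t, a < t → HasDerivAt (v k) (v (k + 1) t) t) :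
    (∀ t, a < t → iteratedDeriv N u t = v N t) ∧ ContDiffOn ℝ (N : ℕ∞) u (Ioi a) := by
  have key : ∀ k ≤ N, ∀ t, a < t → iteratedDeriv k u t = v k t := by
    intro k
    induction k with
    | zero => intro _ t ht; simpa using h0 t ht
    | succ k ih =>
      intro hk t ht
      rw [iteratedDeriv_succ]
      have : iteratedDeriv k u =ᶠ[nhds t] v k := by
        filter_upwards [Ioi_mem_nhds ht] with s hs using ih (by omega) s hs
      rw [this.deriv_eq]
      exact (hd k (by omega) t ht).deriv
  refine ⟨key N le_rfl, ?_⟩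
  apply contDiffOn_of_differentiableOn_deriv
  intro m hm t ht
  have hm' : m ≤ N := by exact_mod_cast hm
  have : DifferentiableWithinAt ℝ (v m) (Ioi a) t :=
    (hd m hm' t ht).differentiableAt.differentiableWithinAt
  have heq : ∀ s ∈ Ioi a, iteratedDerivWithin m u (Ioi a) s = v m s := by
   intro s hs
   rw [iteratedDerivWithin_of_isOpen isOpen_Ioi hs]
   exact key m hm' s hs
  exact this.congr heq (heq t ht)

section main
variable {B : Type*} [NormedAddCommGroup B] [NormedSpace ℂ B] [CompleteSpace B]
    (L L' T C R₀ R : ℝ) (g : ℂ → B)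

/-- integrand on the contour -/
noncomputable def Fk (k : ℕ) (t σ : ℝ) : B :=
  ((-Complex.I * ga L R σ) ^ k * Complex.exp (-Complex.I * t * ga L R σ) * ga' L σ) • g (ga L R σ)

lemma Fk_bound (hL : 0 < L) (hLL' : L < L') (hT : 0 ≤ T) (hC : 0 < C)
    (hR₀ : 1 < R₀) (hR : R₀ < R)
    (hb : ∀ z ∈ Om L' R₀, ‖g z‖ ≤ C * z.re ^ (-2 : ℤ) * Real.exp (T * |z.im|))
    (N k : ℕ) (hk : k ≤ N + 1) (t σ : ℝ) (ht : T + ((N : ℝ) + 1) / L ≤ t) (h : R ≤ σ) :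
    ‖Fk L R g k t σ‖ ≤ ((1 + L) ^ (N + 1) * R ^ (N + 1) * (1 + L) * C) * σ ^ (-2 : ℤ) := by
  have hR1 : 1 < R := by linarith
  have hσ : 0 < σ := by linarith
  have hl := log_nn hR1 h
  have e1 : ‖(-Complex.I * ga L R σ) ^ k‖ ≤ (1 + L) ^ (N + 1) * σ ^ (N + 1) := by
    rw [norm_pow, norm_mul, norm_neg, Complex.norm_I, one_mul, ← mul_pow]
    calc ‖ga L R σ‖ ^ k ≤ ((1 + L) * σ) ^ k := by gcongr; exact ga_norm L R hL hR1 σ h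
      _ ≤ _ := pow_le_pow_right₀ (by nlinarith) hk
  have e2 : ‖g (ga L R σ)‖ ≤ C * σ ^ (-2 : ℤ) * Real.exp (T * (L * Real.log (σ / R))) := by
    have := hb _ (ga_mem L L' R₀ R hL hLL' hR₀ hR σ h)
    rwa [ga_re, ga_im, abs_neg, abs_of_nonneg (by positivity)] at this
  have e3 : ‖Complex.exp (-Complex.I * t * ga L R σ)‖ = Real.exp (-(t * (L * Real.log (σ / R)))) := by
    rw [exp_norm, ga_im]; ring_nf
  have e4 := ga'_norm L R hL hR1 σ h
  have e5 : Real.exp (-(t * (L * Real.log (σ / R)))) * Real.exp (T * (L * Real.log (σ / R)))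
      ≤ R ^ (N + 1) / σ ^ (N + 1) := by
    have : R ^ (N + 1) / σ ^ (N + 1) = Real.exp (-((N + 1 : ℕ) * Real.log (σ / R))) := by
      rw [← mul_neg, Real.exp_nat_mul, Real.exp_neg, Real.exp_log (by positivity), inv_div, div_pow]
    rw [this, ← Real.exp_add]
    apply Real.exp_le_exp.2
    have h6 : (N : ℝ) + 1 ≤ (t - T) * L := by
      rw [← div_le_iff₀ hL]; linarith
    push_cast
    nlinarith [mul_le_mul_of_nonneg_right h6 hl]
  rw [Fk, norm_smul, norm_mul, norm_mul, e3]
  calc _ ≤ ((1 + L) ^ (N + 1) * σ ^ (N + 1)) * Real.exp (-(t * (L * Real.log (σ / R)))) * (1 + L)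
        * (C * σ ^ (-2 : ℤ) * Real.exp (T * (L * Real.log (σ / R)))) := by gcongr
    _ = ((1 + L) ^ (N + 1) * σ ^ (N + 1)) * (1 + L) * C * σ ^ (-2 : ℤ) *
        (Real.exp (-(t * (L * Real.log (σ / R)))) * Real.exp (T * (L * Real.log (σ / R)))) := by ring
    _ ≤ ((1 + L) ^ (N + 1) * σ ^ (N + 1)) * (1 + L) * C * σ ^ (-2 : ℤ) *
        (R ^ (N + 1) / σ ^ (N + 1)) := by gcongr
    _ = _ := by field_simp

lemma Fk_cont (hL : 0 < L) (hLL' : L < L')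
    (hR₀ : 1 < R₀) (hR : R₀ < R) (hg : DifferentiableOn ℂ g (Om L' R₀)) (k : ℕ) (t : ℝ) :
    ContinuousOn (Fk L R g k t) (Ici R) := by
  have hc : ContinuousOn (ga L R) (Ici R) := fun σ hσ =>
    (ga_deriv L R (by linarith) σ hσ).continuousAt.continuousWithinAt
  have hc' : ContinuousOn (ga' L) (Ici R) := by
    refine continuousOn_const.sub (continuousOn_const.mul ?_)
    refine Complex.continuous_ofReal.comp_continuousOn ?_
    refine continuousOn_const.div continuousOn_id ?_
    intro x (hx : R ≤ x)
    show x ≠ 0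
    linarith
  refine ContinuousOn.smul ?_ (hg.continuousOn.comp hc
    (fun σ hσ => ga_mem L L' R₀ R hL hLL' hR₀ hR σ hσ))
  exact (((continuousOn_const.mul hc).pow k).mul (continuousOn_const.mul hc).cexp).mul hc'

lemma Fk_meas (hL : 0 < L) (hLL' : L < L')
    (hR₀ : 1 < R₀) (hR : R₀ < R) (hg : DifferentiableOn ℂ g (Om L' R₀)) (k : ℕ) (t : ℝ) :
    AEStronglyMeasurable (Fk L R g k t) (volume.restrict (Ioi R)) :=
  ((Fk_cont L L' R₀ R g hL hLL' hR₀ hR hg k t).mono Ioi_subset_Ici_self).aestronglyMeasurable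
    measurableSet_Ioi

lemma Fk_int (hL : 0 < L) (hLL' : L < L') (hT : 0 ≤ T) (hC : 0 < C)
    (hR₀ : 1 < R₀) (hR : R₀ < R) (hg : DifferentiableOn ℂ g (Om L' R₀))
    (hb : ∀ z ∈ Om L' R₀, ‖g z‖ ≤ C * z.re ^ (-2 : ℤ) * Real.exp (T * |z.im|))
    (N k : ℕ) (hk : k ≤ N + 1) (t : ℝ) (ht : T + ((N : ℝ) + 1) / L ≤ t) :
    IntegrableOn (Fk L R g k t) (Ioi R) := by
  refine Integrable.mono' (integrable_pow R (by linarith)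
    ((1 + L) ^ (N + 1) * R ^ (N + 1) * (1 + L) * C)) (Fk_meas L L' R₀ R g hL hLL' hR₀ hR hg k t) ?_
  filter_upwards [ae_restrict_mem measurableSet_Ioi] with σ hσ
  exact Fk_bound L L' T C R₀ R g hL hLL' hT hC hR₀ hR hb N k hk t σ ht (le_of_lt hσ)

lemma Fk_deriv (hL : 0 < L) (hLL' : L < L') (hT : 0 ≤ T) (hC : 0 < C)
    (hR₀ : 1 < R₀) (hR : R₀ < R) (hg : DifferentiableOn ℂ g (Om L' R₀))
    (hb : ∀ z ∈ Om L' R₀, ‖g z‖ ≤ C * z.re ^ (-2 : ℤ) * Real.exp (T * |z.im|))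
    (N k : ℕ) (hk : k ≤ N) (t : ℝ) (ht : T + ((N : ℝ) + 1) / L < t) :
    HasDerivAt (fun t => ∫ σ in Ioi R, Fk L R g k t σ) (∫ σ in Ioi R, Fk L R g (k + 1) t σ) t := by
  refine (hasDerivAt_integral_of_dominated_loc_of_deriv_le (Ioi_mem_nhds ht)
    (Filter.Eventually.of_forall fun s => Fk_meas L L' R₀ R g hL hLL' hR₀ hR hg k s)
    (Fk_int L L' T C R₀ R g hL hLL' hT hC hR₀ hR hg hb N k (by omega) t ht.le)
    (F' := Fk L R g (k + 1))
    (Fk_meas L L' R₀ R g hL hLL' hR₀ hR hg (k + 1) t) ?_ (integrable_pow R (by linarith)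
    ((1 + L) ^ (N + 1) * R ^ (N + 1) * (1 + L) * C)) ?_).2
  · filter_upwards [ae_restrict_mem measurableSet_Ioi] with σ hσ s hs
    exact Fk_bound L L' T C R₀ R g hL hLL' hT hC hR₀ hR hb N (k + 1) (by omega) s σ
      (le_of_lt hs) (le_of_lt hσ)
  · refine Filter.Eventually.of_forall fun σ s _ => ?_
    have h1 : HasDerivAt (fun s : ℝ => -Complex.I * (s : ℂ) * ga L R σ)
        (-Complex.I * 1 * ga L R σ) s :=
      (((hasDerivAt_id s).ofReal_comp).const_mul (-Complex.I)).mul_const _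
    have h2 := ((h1.cexp.const_mul ((-Complex.I * ga L R σ) ^ k)).mul_const (ga' L σ)).smul_const
      (g (ga L R σ))
    refine h2.congr_deriv ?_
    rw [Fk]
    congr 1
    ring

lemma real_int (hL : 0 < L) (hLL' : L < L')
    (hR₀ : 1 < R₀) (hR : R₀ < R) (hg : DifferentiableOn ℂ g (Om L' R₀))
    (hb : ∀ z ∈ Om L' R₀, ‖g z‖ ≤ C * z.re ^ (-2 : ℤ) * Real.exp (T * |z.im|)) (t : ℝ) :
    IntegrableOn (fun σ : ℝ => Complex.exp (-Complex.I * (t : ℂ) * (σ : ℂ)) • g (σ : ℂ)) (Ioi R) := by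
  have hm : ∀ σ ∈ Ioi R, ((σ : ℝ) : ℂ) ∈ Om L' R₀ := fun σ hσ =>
    real_mem L' R₀ R (by linarith) hR₀ hR σ (le_of_lt hσ)
  refine Integrable.mono' (integrable_pow R (by linarith) C) ?_ ?_
  · refine ContinuousOn.aestronglyMeasurable ?_ measurableSet_Ioi
    refine ContinuousOn.smul (by fun_prop) ?_
    exact hg.continuousOn.comp Complex.continuous_ofReal.continuousOn hm
  · filter_upwards [ae_restrict_mem measurableSet_Ioi] with σ hσ
    have := hb _ (hm σ hσ)
    rw [norm_smul, exp_norm]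
    simpa using this

lemma contour (hL : 0 < L) (hLL' : L < L') (hT : 0 ≤ T) (hC : 0 < C)
    (hR₀ : 1 < R₀) (hR : R₀ < R) (hg : DifferentiableOn ℂ g (Om L' R₀))
    (hb : ∀ z ∈ Om L' R₀, ‖g z‖ ≤ C * z.re ^ (-2 : ℤ) * Real.exp (T * |z.im|))
    (t : ℝ) (ht : T ≤ t) (hi : IntegrableOn (Fk L R g 0 t) (Ioi R)) :
    ∫ σ in Ioi R, Complex.exp (-Complex.I * (t : ℂ) * (σ : ℂ)) • g (σ : ℂ) =
      ∫ σ in Ioi R, Fk L R g 0 t σ := by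
  have hR1 : 1 < R := by linarith
  have hrm : ∀ σ, R ≤ σ → ((σ : ℝ) : ℂ) ∈ Om L' R₀ := fun σ hσ =>
    real_mem L' R₀ R (by linarith) hR₀ hR σ hσ
  have hgm : ∀ σ, R ≤ σ → ga L R σ ∈ Om L' R₀ := fun σ hσ =>
    ga_mem L L' R₀ R hL hLL' hR₀ hR σ hσ
  set h : ℂ → B := fun z => Complex.exp (-Complex.I * (t : ℂ) * z) • g z with hh
  have hhd : DifferentiableOn ℂ h (Om L' R₀) := by
    refine DifferentiableOn.smul ?_ hg
    fun_prop
  obtain ⟨H, hH'⟩ := (Om_convex L' R₀ (by linarith) hR₀).exists_forall_hasDerivWithinAt hhd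
  have hH : ∀ z ∈ Om L' R₀, HasDerivAt H (h z) z := fun z hz =>
    (hH' z hz).hasDerivAt ((Om_open L' R₀ hR₀).mem_nhds hz)
  have hri := real_int L L' T C R₀ R g hL hLL' hR₀ hR hg hb t
  have hD : ∀ σ ∈ Ici R, HasDerivAt (fun σ : ℝ => H (ga L R σ) - H (σ : ℂ))
      (Fk L R g 0 t σ - h σ) σ := by
    intro σ hσ
    have a1 : HasDerivAt (fun σ : ℝ => H (ga L R σ)) (ga' L σ • h (ga L R σ)) σ :=
      (hH _ (hgm σ hσ)).scomp σ (ga_deriv L R hR1 σ hσ)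
    have a2 : HasDerivAt (fun σ : ℝ => H (σ : ℂ)) ((1 : ℂ) • h (σ : ℂ)) σ :=
      (hH _ (hrm σ hσ)).scomp σ ((hasDerivAt_id σ).ofReal_comp)
    refine (a1.sub a2).congr_deriv ?_
    rw [one_smul, Fk, hh]
    simp only [smul_smul, pow_zero, one_mul, mul_comm, mul_one]
  have hlim : Filter.Tendsto (fun σ : ℝ => H (ga L R σ) - H (σ : ℂ)) Filter.atTop (nhds 0) := by
    have hlim0 : Filter.Tendsto (fun σ : ℝ => C * L * σ⁻¹) Filter.atTop (nhds 0) := by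
      simpa using (tendsto_inv_atTop_zero (𝕜 := ℝ)).const_mul (C * L)
    refine squeeze_zero_norm' ?_ hlim0
    filter_upwards [Filter.eventually_ge_atTop R] with σ hσ
    have hσ0 : 0 < σ := by linarith
    have hl := log_nn hR1 hσ
    have hseg : ∀ z ∈ segment ℝ (σ : ℂ) (ga L R σ), z.re = σ ∧ z.im ≤ 0 ∧
        -(L * Real.log (σ / R)) ≤ z.im := by
      rintro z ⟨a, b, ha, hb, hab, rfl⟩
      have hLl : 0 ≤ L * Real.log (σ / R) := by positivity
      simp only [Complex.add_re, Complex.add_im, Complex.real_smul, Complex.re_ofReal_mul,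
        Complex.im_ofReal_mul, ga_re, ga_im, Complex.ofReal_re, Complex.ofReal_im]
      refine ⟨by rw [← add_mul, hab, one_mul], by nlinarith, by nlinarith⟩
    have hmv := (convex_segment (𝕜 := ℝ) (σ : ℂ) (ga L R σ)).norm_image_sub_le_of_norm_hasDerivWithin_le
      (𝕜 := ℂ) (f := H) (f' := h) (C := C * σ ^ (-2 : ℤ)) (fun z hz => (hH z (by
        obtain ⟨b1, b2, b3⟩ := hseg z hz
        exact seg_mem L L' R₀ R hL hLL' hR₀ hR z (by linarith) (by rw [b1]; exact b3) b2)).hasDerivWithinAt)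
      (fun z hz => by
        obtain ⟨b1, b2, b3⟩ := hseg z hz
        have := hb z (seg_mem L L' R₀ R hL hLL' hR₀ hR z (by linarith) (by rw [b1]; exact b3) b2)
        rw [hh]
        simp only
        rw [norm_smul, exp_norm]
        rw [b1, abs_of_nonpos b2] at this
        calc _ ≤ Real.exp (t * z.im) * (C * σ ^ (-2 : ℤ) * Real.exp (T * -z.im)) := by gcongr
          _ = C * σ ^ (-2 : ℤ) * Real.exp ((t - T) * z.im) := by
            rw [mul_left_comm, ← Real.exp_add]; ring_nf
          _ ≤ C * σ ^ (-2 : ℤ) * 1 := by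
            gcongr
            exact Real.exp_le_one_iff.2 (mul_nonpos_of_nonneg_of_nonpos (by linarith) b2)
          _ = _ := mul_one _)
      (left_mem_segment ℝ _ _) (right_mem_segment ℝ _ _)
    refine hmv.trans ?_
    have : ‖ga L R σ - (σ : ℂ)‖ = L * Real.log (σ / R) := by
      rw [ga, sub_sub_cancel_left, norm_neg, norm_mul, Complex.norm_I, one_mul, Complex.norm_real]
      exact abs_of_nonneg (by positivity)
    rw [this]
    calc _ ≤ C * σ ^ (-2 : ℤ) * (L * σ) := by gcongr; exact log_le hR1 hσ
      _ = _ := by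
        rw [zpow_neg]; norm_cast; field_simp
  have hfin := integral_Ioi_of_hasDerivAt_of_tendsto' hD (hi.sub hri) hlim
  have hzero : ga L R R = (R : ℂ) := by
    rw [ga, div_self (by linarith)]; simp
  rw [integral_sub hi hri, hzero, sub_self, sub_self] at hfin
  exact (sub_eq_zero.1 hfin).symm

end main

end LogRegion

/-- Analyticity of `g` in a logarithmic region of slope `L` below the real
axis with bound `C (Re λ)^{−2} e^{T|Im λ|}` forces the Fourier-type integral
`u(t) = ∫_R^∞ e^{−itσ} g(σ) dσ` to gain derivatives at rate `1/L`: `u` is `C^N` on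
`(T + (N+1)/L, ∞)` and `u^{(N)}` is bounded on `[T + (N+1+ε)/L, ∞)` for every `ε > 0`. -/
theorem log_region_analyticity_implies_smoothing
    {B : Type*} [NormedAddCommGroup B] [NormedSpace ℂ B] [CompleteSpace B]
    (L L' T C R₀ R : ℝ) (hL : 0 < L) (hLL' : L < L') (hT : 0 ≤ T) (hC : 0 < C)
    (hR₀ : 1 < R₀) (hR : R₀ < R)
    (g : ℂ → B)
    (hgHol : DifferentiableOn ℂ g
      {z : ℂ | R₀ < z.re ∧ -L' * Real.log z.re < z.im ∧ z.im < 1})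
    (hgBound : ∀ z : ℂ, R₀ < z.re → -L' * Real.log z.re < z.im → z.im < 1 →
      ‖g z‖ ≤ C * z.re ^ (-2 : ℤ) * Real.exp (T * |z.im|)) :
    (∀ t : ℝ, IntegrableOn (fun σ : ℝ =>
        Complex.exp (-Complex.I * (t : ℂ) * (σ : ℂ)) • g (σ : ℂ)) (Ioi R)) ∧
    ∀ Nd : ℕ,
      ContDiffOn ℝ (Nd : ℕ∞)
        (fun t : ℝ => ∫ σ in Ioi R, Complex.exp (-Complex.I * (t : ℂ) * (σ : ℂ)) • g (σ : ℂ))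
        (Ioi (T + ((Nd : ℝ) + 1) / L)) ∧
      ∀ ε : ℝ, 0 < ε → ∃ Cb : ℝ,
        ∀ t : ℝ, T + ((Nd : ℝ) + 1 + ε) / L ≤ t →
          ‖iteratedDeriv Nd
              (fun t : ℝ =>
                ∫ σ in Ioi R, Complex.exp (-Complex.I * (t : ℂ) * (σ : ℂ)) • g (σ : ℂ)) t‖
            ≤ Cb := by
  have hb : ∀ z ∈ LogRegion.Om L' R₀, ‖g z‖ ≤ C * z.re ^ (-2 : ℤ) * Real.exp (T * |z.im|) :=
    fun z hz => hgBound z hz.1 hz.2.1 hz.2.2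
  refine ⟨LogRegion.real_int L L' T C R₀ R g hL hLL' hR₀ hR hgHol hb, fun N => ?_⟩
  have hgt : ∀ t : ℝ, T + ((N : ℝ) + 1) / L < t → T ≤ t := by
    intro t ht
    have : 0 ≤ ((N : ℝ) + 1) / L := by positivity
    linarith
  obtain ⟨h1, h2⟩ := LogRegion.abstract_smooth
    (fun t : ℝ => ∫ σ in Ioi R, Complex.exp (-Complex.I * (t : ℂ) * (σ : ℂ)) • g (σ : ℂ))
    (fun k t => ∫ σ in Ioi R, LogRegion.Fk L R g k t σ) (T + ((N : ℝ) + 1) / L) N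
    (fun t ht => LogRegion.contour L L' T C R₀ R g hL hLL' hT hC hR₀ hR hgHol hb t (hgt t ht)
      (LogRegion.Fk_int L L' T C R₀ R g hL hLL' hT hC hR₀ hR hgHol hb N 0 (by omega) t ht.le))
    (fun k hk t ht => LogRegion.Fk_deriv L L' T C R₀ R g hL hLL' hT hC hR₀ hR hgHol hb N k hk t ht)
  refine ⟨h2, fun ε hε => ⟨∫ σ in Ioi R,
    ((1 + L) ^ (N + 1) * R ^ (N + 1) * (1 + L) * C) * σ ^ (-2 : ℤ), fun t ht => ?_⟩⟩
  have ht' : T + ((N : ℝ) + 1) / L < t := by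
    have : ((N : ℝ) + 1) / L < ((N : ℝ) + 1 + ε) / L := by
      rw [div_lt_div_iff_of_pos_right hL]; linarith
    linarith
  rw [h1 t ht']
  refine norm_integral_le_of_norm_le (LogRegion.integrable_pow R (by linarith) _) ?_
  filter_upwards [ae_restrict_mem measurableSet_Ioi] with σ hσ
  exact LogRegion.Fk_bound L L' T C R₀ R g hL hLL' hT hC hR₀ hR hb N N (by omega) t σ ht'.le
    (le_of_lt hσ)
end
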